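/- Let N be a finite set, A, B, C pairwise disjoint subsets of N with A, B nonempty, with enumerations A = {a_1, …, a_m}, B = {b_1, …, b_n}, and let θ be a representation of u_{⟨A,B|C⟩} with terms u_θ(s,t). Then θ has no rifts, i.e., Γ(u_θ(s,t)) = abΓ(u_θ(s−1,t−1)) for all 1 ≤ s ≤ |A|−1 and 1 ≤ t ≤ |B|−1, if and only if θ equals the (σ,τ)-permuted standard representation of u_{⟨A,B|C⟩} for some permutations σ of {1,…,m} and τ of {1,…,n}. -/

import Mathlib

open Finset

/-- The semi-elementary imset `u_{⟨A,B|C⟩}` as a `ℤ`-valued function on finite sets. -/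
def uim {α : Type*} [DecidableEq α] (A B C : Finset α) : Finset α → ℤ := fun S =>
  (if S = A ∪ B ∪ C then 1 else 0) + (if S = C then 1 else 0)
    - (if S = A ∪ C then 1 else 0) - (if S = B ∪ C then 1 else 0)

/-- A representation of `u_{⟨A,B|C⟩}` recorded through its terms
`u_θ(s,t) = u_{⟨a_{st}, b_{st} | Γ_{st}⟩}`, one from each class `E^{s,t}_{⟨A,B|C⟩}`
(i.e. with `|A ∩ Γ_{st}| = s`, `|B ∩ Γ_{st}| = t`) for `0 ≤ s ≤ |A|−1`, `0 ≤ t ≤ |B|−1`,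
summing to `u_{⟨A,B|C⟩}`. -/
def IsTermRep {α : Type*} [DecidableEq α] (A B C : Finset α)
    (as bs : ℕ → ℕ → α) (Γs : ℕ → ℕ → Finset α) : Prop :=
  (∀ s t, s < A.card → t < B.card →
      as s t ∈ A ∧ bs s t ∈ B ∧ C ⊆ Γs s t ∧ Γs s t ⊆ A ∪ B ∪ C ∧
      as s t ∉ Γs s t ∧ bs s t ∉ Γs s t ∧
      (A ∩ Γs s t).card = s ∧ (B ∩ Γs s t).card = t) ∧
  ∀ S : Finset α, uim A B C S =
      ∑ s ∈ Finset.range A.card, ∑ t ∈ Finset.range B.card,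
        uim {as s t} {bs s t} (Γs s t) S

theorem uim_comm {α : Type*} [DecidableEq α] (A B C : Finset α) : uim A B C = uim B A C := by
  funext S
  simp only [uim, union_comm A B]
  ring

theorem uim_eq_zero {α : Type*} [DecidableEq α] {A B C S : Finset α}
    (hAC : Disjoint A C) (h0 : (A ∩ S).card ≠ 0) (h1 : (A ∩ S).card ≠ A.card)
    (hAB : Disjoint A B) : uim A B C S = 0 := by
  have e1 : A ∩ (A ∪ B ∪ C) = A := by grind
  have e2 : A ∩ C = ∅ := disjoint_iff_inter_eq_empty.mp hAC
  have e3 : A ∩ (A ∪ C) = A := by grind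
  have e4 : A ∩ (B ∪ C) = ∅ := by
    rw [inter_union_distrib_left, disjoint_iff_inter_eq_empty.mp hAB, e2, union_empty]
  have n1 : S ≠ A ∪ B ∪ C := by rintro rfl; exact h1 (by rw [e1])
  have n2 : S ≠ C := by rintro rfl; exact h0 (by rw [e2, card_empty])
  have n3 : S ≠ A ∪ C := by rintro rfl; exact h1 (by rw [e3])
  have n4 : S ≠ B ∪ C := by rintro rfl; exact h0 (by rw [e4, card_empty])
  simp only [uim, if_neg n1, if_neg n2, if_neg n3, if_neg n4, add_zero, sub_zero]

theorem sum_range_sum_range_ite_eq {α : Type*} [DecidableEq α] {m n p q : ℕ} {S : Finset α}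
    {X : ℕ → ℕ → Finset α} (hp : p < m) (hq : q < n)
    (h : ∀ s < m, ∀ t < n, S = X s t → s = p ∧ t = q) :
    (∑ s ∈ range m, ∑ t ∈ range n, if S = X s t then (1 : ℤ) else 0) =
      if S = X p q then 1 else 0 := by
  rw [sum_eq_single_of_mem p (mem_range.mpr hp), sum_eq_single_of_mem q (mem_range.mpr hq)]
  · intro t ht hne
    exact if_neg fun hS => hne (h p hp t (mem_range.mp ht) hS).2
  · intro s hs hne
    exact sum_eq_zero fun t ht =>
      if_neg fun hS => hne (h s (mem_range.mp hs) t (mem_range.mp ht) hS).1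

theorem sum_range_sum_range_ite_eq_zero {α : Type*} [DecidableEq α] {m n : ℕ} {S : Finset α}
    {X : ℕ → ℕ → Finset α} (h : ∀ s < m, ∀ t < n, S ≠ X s t) :
    (∑ s ∈ range m, ∑ t ∈ range n, if S = X s t then (1 : ℤ) else 0) = 0 :=
  sum_eq_zero fun s hs => sum_eq_zero fun t ht =>
    if_neg (h s (mem_range.mp hs) t (mem_range.mp ht))

/-- The absence of rifts in a representation given by its terms. -/
def NoRifts {α : Type*} [DecidableEq α] (A B : Finset α)
    (as bs : ℕ → ℕ → α) (Γs : ℕ → ℕ → Finset α) : Prop :=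
  ∀ s t, s + 1 < A.card → t + 1 < B.card →
    Γs (s + 1) (t + 1) = insert (as s t) (insert (bs s t) (Γs s t))

theorem NoRifts.swap {α : Type*} [DecidableEq α] {A B : Finset α}
    {as bs : ℕ → ℕ → α} {Γs : ℕ → ℕ → Finset α} (h : NoRifts A B as bs Γs) :
    NoRifts B A (fun s t => bs t s) (fun s t => as t s) (fun s t => Γs t s) :=
  fun s t hs ht => (h t s ht hs).trans (insert_comm _ _ _)

namespace IsTermRep

variable {α : Type*} [DecidableEq α] {A B C : Finset α} {as bs : ℕ → ℕ → α}
  {Γs : ℕ → ℕ → Finset α}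

theorem swap (h : IsTermRep A B C as bs Γs) :
    IsTermRep B A C (fun s t => bs t s) (fun s t => as t s) (fun s t => Γs t s) := by
  refine ⟨fun s t hs ht => ?_, fun S => ?_⟩
  · obtain ⟨h1, h2, h3, h4, h5, h6, h7, h8⟩ := h.1 t s ht hs
    exact ⟨h2, h1, h3, by rwa [union_comm B A], h6, h5, h8, h7⟩
  · rw [uim_comm, h.2 S, sum_comm]
    simp only [uim_comm]

theorem card_insert_left (h : IsTermRep A B C as bs Γs) {s t : ℕ}
    (hs : s < A.card) (ht : t < B.card) : (A ∩ insert (as s t) (Γs s t)).card = s + 1 := by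
  obtain ⟨h1, -, -, -, h5, -, h7, -⟩ := h.1 s t hs ht
  rw [inter_insert_of_mem h1, card_insert_of_notMem (by simp [h5]), h7]

theorem inter_insert_right (h : IsTermRep A B C as bs Γs) (hAB : Disjoint A B) {s t : ℕ}
    (hs : s < A.card) (ht : t < B.card) (X : Finset α) :
    A ∩ insert (bs s t) X = A ∩ X :=
  inter_insert_of_notMem fun h' => disjoint_left.mp hAB h' (h.1 s t hs ht).2.1

theorem sum_eq (h : IsTermRep A B C as bs Γs) (S : Finset α) :
    uim A B C S =
      (∑ s ∈ range A.card, ∑ t ∈ range B.card,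
        if S = insert (as s t) (insert (bs s t) (Γs s t)) then 1 else 0) +
      (∑ s ∈ range A.card, ∑ t ∈ range B.card, if S = Γs s t then 1 else 0) -
      (∑ s ∈ range A.card, ∑ t ∈ range B.card, if S = insert (as s t) (Γs s t) then 1 else 0) -
      (∑ s ∈ range A.card, ∑ t ∈ range B.card,
        if S = insert (bs s t) (Γs s t) then 1 else 0) := by
  rw [h.2 S]
  simp only [uim, sum_add_distrib, sum_sub_distrib, insert_eq, union_assoc]
  congr!

/-- The cardinalities of the `A`-parts of the four sets in the support of a term. -/
theorem card_inter (h : IsTermRep A B C as bs Γs) (hAB : Disjoint A B) {s t : ℕ}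
    (hs : s < A.card) (ht : t < B.card) :
    (A ∩ Γs s t).card = s ∧ (A ∩ insert (as s t) (Γs s t)).card = s + 1 ∧
      (A ∩ insert (bs s t) (Γs s t)).card = s ∧
      (A ∩ insert (as s t) (insert (bs s t) (Γs s t))).card = s + 1 := by
  have h7 := (h.1 s t hs ht).2.2.2.2.2.2.1
  refine ⟨h7, h.card_insert_left hs ht, ?_, ?_⟩
  · rw [h.inter_insert_right hAB hs ht, h7]
  · rw [insert_comm, h.inter_insert_right hAB hs ht, h.card_insert_left hs ht]

/-- The cardinalities of the `B`-parts of the four sets in the support of a term. -/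
theorem card_inter' (h : IsTermRep A B C as bs Γs) (hAB : Disjoint A B) {s t : ℕ}
    (hs : s < A.card) (ht : t < B.card) :
    (B ∩ Γs s t).card = t ∧ (B ∩ insert (as s t) (Γs s t)).card = t ∧
      (B ∩ insert (bs s t) (Γs s t)).card = t + 1 ∧
      (B ∩ insert (as s t) (insert (bs s t) (Γs s t))).card = t + 1 := by
  obtain ⟨h1, h2, h3, h4⟩ := h.swap.card_inter hAB.symm ht hs
  exact ⟨h1, h3, h2, by rwa [insert_comm]⟩

theorem succ_zero (h : IsTermRep A B C as bs Γs) (hAB : Disjoint A B) (hAC : Disjoint A C)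
    {s : ℕ} (hs : s + 1 < A.card) (hB : 0 < B.card) :
    Γs (s + 1) 0 = insert (as s 0) (Γs s 0) := by
  set S := insert (as s 0) (Γs s 0) with hS
  have hcA : (A ∩ S).card = s + 1 := (h.card_inter hAB (by omega) hB).2.1
  have hcB : (B ∩ S).card = 0 := (h.card_inter' hAB (by omega) hB).2.1
  have key := h.sum_eq S
  rw [uim_eq_zero hAC (by omega) (by omega) hAB,
    sum_range_sum_range_ite_eq_zero (X := fun s t => insert (as s t) (insert (bs s t) (Γs s t))),
    sum_range_sum_range_ite_eq hs hB,
    sum_range_sum_range_ite_eq (p := s) (q := 0) (X := fun s t => insert (as s t) (Γs s t))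
      (by omega) hB,
    sum_range_sum_range_ite_eq_zero (X := fun s t => insert (bs s t) (Γs s t)),
    if_pos hS] at key
  · by_contra hne
    rw [if_neg (Ne.symm hne)] at key
    omega
  all_goals
    intro s' hs' t' ht'
    have c1 := h.card_inter hAB hs' ht'
    have c2 := h.card_inter' hAB hs' ht'
    intro hS'
    rw [← hS'] at c1 c2
    omega

theorem succ_succ (h : IsTermRep A B C as bs Γs) (hR : NoRifts A B as bs Γs)
    (hAB : Disjoint A B) (hAC : Disjoint A C)
    {s t : ℕ} (hs : s + 1 < A.card) (ht : t + 1 < B.card) :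
    Γs (s + 1) (t + 1) = insert (as s (t + 1)) (Γs s (t + 1)) := by
  set S := Γs (s + 1) (t + 1) with hS
  have hcA : (A ∩ S).card = s + 1 := (h.card_inter hAB hs ht).1
  have hcB : (B ∩ S).card = t + 1 := (h.card_inter' hAB hs ht).1
  have key := h.sum_eq S
  rw [uim_eq_zero hAC (by omega) (by omega) hAB,
    sum_range_sum_range_ite_eq (p := s) (q := t)
      (X := fun s t => insert (as s t) (insert (bs s t) (Γs s t))) (by omega) (by omega),
    sum_range_sum_range_ite_eq hs ht,
    sum_range_sum_range_ite_eq (p := s) (q := t + 1) (X := fun s t => insert (as s t) (Γs s t))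
      (by omega) ht,
    sum_range_sum_range_ite_eq (p := s + 1) (q := t) (X := fun s t => insert (bs s t) (Γs s t))
      hs (by omega),
    if_pos hS, if_pos (hR s t hs ht)] at key
  · by_contra hne
    rw [if_neg hne] at key
    split_ifs at key <;> omega
  all_goals
    intro s' hs' t' ht'
    have c1 := h.card_inter hAB hs' ht'
    have c2 := h.card_inter' hAB hs' ht'
    intro hS'
    rw [← hS'] at c1 c2
    omega

theorem succ_left (h : IsTermRep A B C as bs Γs) (hR : NoRifts A B as bs Γs)
    (hAB : Disjoint A B) (hAC : Disjoint A C)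
    {s t : ℕ} (hs : s + 1 < A.card) (ht : t < B.card) :
    Γs (s + 1) t = insert (as s t) (Γs s t) := by
  cases t with
  | zero => exact h.succ_zero hAB hAC hs ht
  | succ t => exact h.succ_succ hR hAB hAC hs ht

theorem inter_eq_inter_zero (h : IsTermRep A B C as bs Γs) (hR : NoRifts A B as bs Γs)
    (hAB : Disjoint A B) (hBC : Disjoint B C)
    {s t : ℕ} (hs : s < A.card) (ht : t < B.card) : A ∩ Γs s t = A ∩ Γs s 0 := by
  induction t with
  | zero => rfl
  | succ t ih =>
    rw [← ih (by omega), h.swap.succ_left hR.swap hAB.symm hBC ht hs,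
      h.inter_insert_right hAB hs (by omega)]

theorem left_eq_zero (h : IsTermRep A B C as bs Γs) (hR : NoRifts A B as bs Γs)
    (hAB : Disjoint A B) (hAC : Disjoint A C) (hBC : Disjoint B C)
    {s t : ℕ} (hs : s < A.card) (ht : t < B.card) : as s t = as s 0 := by
  have hB : 0 < B.card := by omega
  have key : A ∩ insert (as s t) (Γs s t) = A ∩ insert (as s 0) (Γs s 0) := by
    rcases Nat.lt_or_ge (s + 1) A.card with hs' | hs'
    · rw [← h.succ_left hR hAB hAC hs' ht, ← h.succ_left hR hAB hAC hs' hB,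
        h.inter_eq_inter_zero hR hAB hBC hs' ht]
    · rw [eq_of_subset_of_card_le inter_subset_left (by rwa [h.card_insert_left hs ht]),
        eq_of_subset_of_card_le inter_subset_left (by rwa [h.card_insert_left hs hB])]
  have hΓ := h.inter_eq_inter_zero hR hAB hBC hs ht
  obtain ⟨h1, -, -, -, h5, -⟩ := h.1 s t hs ht
  have m1 : as s t ∈ A ∩ insert (as s 0) (Γs s 0) := key ▸ by simp [h1]
  have m2 : as s t ∉ A ∩ Γs s 0 := hΓ ▸ by simp [h5]
  grind

theorem gamma_zero_zero (h : IsTermRep A B C as bs Γs) (hA : 0 < A.card) (hB : 0 < B.card) :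
    Γs 0 0 = C := by
  obtain ⟨-, -, h3, h4, -, -, h7, h8⟩ := h.1 0 0 hA hB
  rw [card_eq_zero, ← disjoint_iff_inter_eq_empty] at h7 h8
  refine Subset.antisymm (fun x hx => ?_) h3
  have hA := disjoint_right.mp h7 hx
  have hB := disjoint_right.mp h8 hx
  simpa [hA, hB] using h4 hx

theorem gamma_eq (h : IsTermRep A B C as bs Γs) (hR : NoRifts A B as bs Γs)
    (hAB : Disjoint A B) (hAC : Disjoint A C) (hBC : Disjoint B C)
    {s t : ℕ} (hs : s < A.card) (ht : t < B.card) :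
    Γs s t = (range s).image (fun k => as k 0) ∪ (range t).image (fun k => bs 0 k) ∪ C := by
  induction t with
  | zero =>
    induction s with
    | zero => simp [h.gamma_zero_zero hs ht]
    | succ s ih =>
      rw [h.succ_left hR hAB hAC hs ht, ih (by omega), range_add_one, image_insert]
      simp only [insert_union]
  | succ t ih =>
    rw [h.swap.succ_left hR.swap hAB.symm hBC ht hs, ih (by omega), range_add_one, image_insert,
      h.swap.left_eq_zero hR.swap hAB.symm hBC hAC (by omega : t < B.card) hs]
    simp only [insert_union, union_insert]

theorem left_injOn (h : IsTermRep A B C as bs Γs) (hR : NoRifts A B as bs Γs)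
    (hAB : Disjoint A B) (hAC : Disjoint A C) (hBC : Disjoint B C) (hB : 0 < B.card)
    {s s' : ℕ} (hs : s < A.card) (hs' : s' < A.card) (e : as s 0 = as s' 0) : s = s' := by
  wlog hlt : s < s' generalizing s s'
  · rcases Nat.lt_or_ge s' s with h' | h'
    · exact (this hs' hs e.symm h').symm
    · omega
  · refine absurd ?_ (h.1 s' 0 hs' hB).2.2.2.2.1
    rw [h.gamma_eq hR hAB hAC hBC hs' hB, ← e]
    exact mem_union_left _ (mem_union_left _
      (mem_image_of_mem (fun k => as k 0) (mem_range.mpr hlt)))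

/-- The elements `as s 0` enumerate `A` along a permutation. -/
theorem exists_perm (h : IsTermRep A B C as bs Γs) (hR : NoRifts A B as bs Γs)
    (hAB : Disjoint A B) (hAC : Disjoint A C) (hBC : Disjoint B C) (hB : 0 < B.card)
    {m : ℕ} (hm : A.card = m) {a : Fin m → α} (haA : A = image a univ) :
    ∃ σ : Equiv.Perm (Fin m), ∀ i : Fin m, as i 0 = a (σ i) := by
  have hex : ∀ i : Fin m, ∃ k, a k = as i 0 := fun i => by
    simpa [haA] using (h.1 i 0 (hm ▸ i.2) hB).1
  choose f hf using hex
  have hinj : Function.Injective f := fun i j hij =>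
    Fin.ext <| h.left_injOn hR hAB hAC hBC hB (hm ▸ i.2) (hm ▸ j.2) (by rw [← hf, ← hf, hij])
  exact ⟨Equiv.ofBijective f (Finite.injective_iff_bijective.mp hinj), fun i => (hf i).symm⟩

end IsTermRep

theorem image_Iio_eq_image_range {α : Type*} [DecidableEq α] {m : ℕ} {f : Fin m → α} {g : ℕ → α}
    (h : ∀ i : Fin m, g i = f i) (i : Fin m) : (Iio i).image f = (range i).image g := by
  ext x
  simp only [mem_image, mem_Iio, mem_range]
  constructor
  · rintro ⟨k, hk, rfl⟩
    exact ⟨k, hk, h k⟩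
  · rintro ⟨k, hk, rfl⟩
    exact ⟨⟨k, hk.trans i.2⟩, hk, (h ⟨k, hk.trans i.2⟩).symm⟩

theorem image_Iio_succ {α : Type*} [DecidableEq α] {m k : ℕ} (f : Fin m → α) (hk : k + 1 < m) :
    (Iio (⟨k + 1, hk⟩ : Fin m)).image f =
      insert (f ⟨k, by omega⟩) ((Iio (⟨k, by omega⟩ : Fin m)).image f) := by
  rw [← image_insert]
  congr 1
  ext x
  simp only [mem_Iio, mem_insert, Fin.lt_def, Fin.ext_iff]
  omega

theorem stmt18 {α : Type*} [DecidableEq α] (A B C : Finset α) {m n : ℕ}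
    (a : Fin m → α) (b : Fin n → α)
    (as bs : ℕ → ℕ → α) (Γs : ℕ → ℕ → Finset α)
    (hAB : Disjoint A B) (hAC : Disjoint A C) (hBC : Disjoint B C)
    (hAne : A.Nonempty) (hBne : B.Nonempty)
    (ha : Function.Injective a) (hb : Function.Injective b)
    (haA : A = Finset.image a Finset.univ) (hbB : B = Finset.image b Finset.univ)
    (hθ : IsTermRep A B C as bs Γs) :
    (∀ s t, 1 ≤ s → s < A.card → 1 ≤ t → t < B.card →
        Γs s t = insert (as (s - 1) (t - 1))
          (insert (bs (s - 1) (t - 1)) (Γs (s - 1) (t - 1)))) ↔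
      ∃ (σ : Equiv.Perm (Fin m)) (τ : Equiv.Perm (Fin n)),
        ∀ (i : Fin m) (j : Fin n),
          as (i : ℕ) (j : ℕ) = a (σ i) ∧ bs (i : ℕ) (j : ℕ) = b (τ j) ∧
          Γs (i : ℕ) (j : ℕ) =
            ((Finset.Iio i).image fun k => a (σ k)) ∪
              ((Finset.Iio j).image fun k => b (τ k)) ∪ C := by
  have hm : A.card = m := by rw [haA, card_image_of_injective _ ha, card_univ, Fintype.card_fin]
  have hn : B.card = n := by rw [hbB, card_image_of_injective _ hb, card_univ, Fintype.card_fin]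
  constructor
  · intro hR'
    have hR : NoRifts A B as bs Γs := fun s t hs ht =>
      hR' (s + 1) (t + 1) (by omega) hs (by omega) ht
    obtain ⟨σ, hσ⟩ := hθ.exists_perm hR hAB hAC hBC hBne.card_pos hm haA
    obtain ⟨τ, hτ⟩ := hθ.swap.exists_perm hR.swap hAB.symm hBC hAC hAne.card_pos hn hbB
    refine ⟨σ, τ, fun i j => ?_⟩
    have hi : (i : ℕ) < A.card := hm ▸ i.2
    have hj : (j : ℕ) < B.card := hn ▸ j.2
    refine ⟨?_, ?_, ?_⟩
    · rw [hθ.left_eq_zero hR hAB hAC hBC hi hj, hσ]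
    · exact (hθ.swap.left_eq_zero hR.swap hAB.symm hBC hAC hj hi).trans (hτ j)
    · rw [hθ.gamma_eq hR hAB hAC hBC hi hj, image_Iio_eq_image_range (g := fun k => as k 0) hσ,
        image_Iio_eq_image_range (g := fun k => bs 0 k) hτ]
  · rintro ⟨σ, τ, h⟩ s t hs hsA ht htB
    obtain ⟨s, rfl⟩ := Nat.exists_eq_add_of_le' hs
    obtain ⟨t, rfl⟩ := Nat.exists_eq_add_of_le' ht
    rw [hm] at hsA
    rw [hn] at htB
    obtain ⟨-, -, h3⟩ := h ⟨s + 1, hsA⟩ ⟨t + 1, htB⟩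
    obtain ⟨h1, h2, h4⟩ := h ⟨s, by omega⟩ ⟨t, by omega⟩
    simp only [Nat.add_sub_cancel] at h1 h2 h3 h4 ⊢
    rw [h3, h1, h2, h4, image_Iio_succ (fun k => a (σ k)), image_Iio_succ (fun k => b (τ k))]
    simp only [insert_union, union_insert]
    exact insert_comm _ _ _
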